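/- Let n ≥ 3, let B be a nondegenerate symmetric bilinear form on ℝⁿ, and let U ⊆ ℝⁿ be a nonempty open connected set. Then the set of smooth conformal Killing vectors of B on U (vector fields ξ : U → ℝⁿ for which there exists a function Ψ with B(Dξ(x)u, v) + B(u, Dξ(x)v) = 2Ψ(x)B(u,v) on U) is a real vector space of dimension (n+1)(n+2)/2. -/

import Mathlib

open Module Set Filter Topology

section FlatConformalKilling

variable {E : Type*} [NormedAddCommGroup E] [NormedSpace ℝ E]

/-- `ξ` is a conformal Killing vector of the constant metric `B` on `U` with conformal
factor `Ψ`. -/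
def IsConformalKillingOn (B : LinearMap.BilinForm ℝ E) (U : Set E) (ξ : E → E) (Ψ : E → ℝ) :
    Prop :=
  ∀ x ∈ U, ∀ u v, B (fderiv ℝ ξ x u) v + B u (fderiv ℝ ξ x v) = 2 * Ψ x * B u v

theorem IsConformalKillingOn.sub {B : LinearMap.BilinForm ℝ E} {U : Set E} {ξ η : E → E}
    {Ψ Φ : E → ℝ} (h : IsConformalKillingOn B U ξ Ψ)
    (h' : IsConformalKillingOn B U η Φ) (hξ : ∀ x ∈ U, DifferentiableAt ℝ ξ x)
    (hη : ∀ x ∈ U, DifferentiableAt ℝ η x) :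
    IsConformalKillingOn B U (ξ - η) (Ψ - Φ) := by
  intro x hx u v
  rw [fderiv_sub (hξ x hx) (hη x hx)]
  simp only [sub_apply, map_sub, LinearMap.sub_apply, Pi.sub_apply]
  linear_combination h x hx u v - h' x hx u v

/-- The Koszul trick. -/
theorem koszul_formula {V : Type*} (G : V → V → V → ℝ) (p : V → ℝ) (b : V → V → ℝ)
    (hG : ∀ w u v, G w u v = G u w v)
    (h : ∀ w u v, G w u v + G w v u = 2 * p w * b u v) (w u v : V) :
    G w u v = p w * b u v + p u * b w v - p v * b w u := by
  have h1 := h w u v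
  have h2 := h u w v
  have h3 := h v w u
  have e1 := hG w u v
  have e2 := hG w v u
  have e3 := hG u v w
  linarith

/-- In dimension at least three, a bilinear form satisfying the integrability condition of the
conformal Killing equation vanishes. -/
theorem eq_zero_of_conformal_integrability [FiniteDimensional ℝ E]
    (hE : 3 ≤ finrank ℝ E) {B : LinearMap.BilinForm ℝ E} (hB : ∀ u v, B u v = B v u)
    (hB' : B.Nondegenerate) (P : E →L[ℝ] E →L[ℝ] ℝ)
    (h : ∀ z w u v, P z u * B w v - P z v * B w u = P w u * B z v - P w v * B z u) : P = 0 := by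
  have : Invertible (2 : ℝ) := invertibleOfNonzero two_ne_zero
  obtain ⟨e, he⟩ := LinearMap.BilinForm.exists_orthogonal_basis (B := B) ⟨hB⟩
  have hne : ∀ i, B (e i) (e i) ≠ 0 := he.not_isOrtho_basis_self_of_separatingLeft hB'.1
  have h0 : ∀ i j, i ≠ j → B (e i) (e j) = 0 := fun i j hij => he hij
  have key : ∀ i j, P (e i) (e j) = 0 := by
    have hoff : ∀ i j, i ≠ j → P (e i) (e j) = 0 := by
      intro i j hij
      obtain ⟨k, hk⟩ : ∃ k, k ∉ ({i, j} : Finset (Fin (finrank ℝ E))) := by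
        by_contra! hc
        have := Finset.card_le_card (fun x _ => hc x : Finset.univ ⊆ _)
        have h2 := Finset.card_le_two (a := i) (b := j)
        rw [Finset.card_univ, Fintype.card_fin] at this
        omega
      simp only [Finset.mem_insert, Finset.mem_singleton, not_or] at hk
      have := h (e i) (e k) (e j) (e k)
      rw [h0 k j hk.2, h0 i k (Ne.symm hk.1), h0 i j hij] at this
      simpa [hne k] using this
    have hdiag : ∀ i k, i ≠ k →
        P (e i) (e i) * B (e k) (e k) = - (P (e k) (e k) * B (e i) (e i)) := by
      intro i k hik
      have := h (e i) (e k) (e i) (e k)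
      rw [h0 k i hik.symm, h0 i k hik] at this
      linarith
    intro i j
    by_cases hij : i = j
    · subst hij
      obtain ⟨k, hk⟩ : ∃ k, k ∉ ({i} : Finset (Fin (finrank ℝ E))) := by
        by_contra! hc
        have := Finset.card_le_card (fun x _ => hc x : Finset.univ ⊆ _)
        rw [Finset.card_univ, Fintype.card_fin, Finset.card_singleton] at this
        omega
      obtain ⟨l, hl⟩ : ∃ l, l ∉ ({i, k} : Finset (Fin (finrank ℝ E))) := by
        by_contra! hc
        have := Finset.card_le_card (fun x _ => hc x : Finset.univ ⊆ _)
        have h2 := Finset.card_le_two (a := i) (b := k)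
        rw [Finset.card_univ, Fintype.card_fin] at this
        omega
      simp only [Finset.mem_insert, Finset.mem_singleton, not_or] at hk hl
      have h1 := hdiag i k (Ne.symm hk)
      have h2 := hdiag i l (Ne.symm hl.1)
      have h3 := hdiag k l (Ne.symm hl.2)
      have hk0 := hne k
      have hl0 := hne l
      have : P (e i) (e i) * (2 * B (e k) (e k) * B (e l) (e l)) = 0 := by
        linear_combination (B (e l) (e l)) * h1 + B (e k) (e k) * h2 - B (e i) (e i) * h3
      simpa [hk0, hl0] using this
    · exact hoff i j hij
  have : (ContinuousLinearMap.coeLM ℝ ∘ₗ (P : E →ₗ[ℝ] E →L[ℝ] ℝ)) = 0 :=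
    LinearMap.ext_basis e e (by simpa using key)
  ext u v
  simpa using LinearMap.congr_fun₂ this u v

theorem skewAdjointSubmodule_apply {B : LinearMap.BilinForm ℝ E} (L : B.skewAdjointSubmodule)
    (u v : E) : B (L.1 u) v = -B u (L.1 v) := by
  simpa using (LinearMap.mem_skewAdjointSubmodule _).1 L.2 u v

/-- The dimension of the Lie algebra of skew-adjoint endomorphisms of a nondegenerate symmetric
bilinear form. -/
theorem finrank_skewAdjointSubmodule [FiniteDimensional ℝ E]
    {B : LinearMap.BilinForm ℝ E} (hB : ∀ u v, B u v = B v u) (hB' : B.Nondegenerate) :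
    finrank ℝ B.skewAdjointSubmodule = (finrank ℝ E).choose 2 := by
  let T : B.skewAdjointSubmodule →ₗ[ℝ] E [⋀^Fin 2]→ₗ[ℝ] ℝ :=
    { toFun L :=
        { MultilinearMap.mk' (fun m : Fin 2 → E => B (L.1 (m 0)) (m 1))
            (by intro m i x y; fin_cases i <;> simp)
            (by intro m i c x; fin_cases i <;> simp) with
          map_eq_zero_of_eq' := by
            intro m i j hm hij
            have : m 0 = m 1 := by
              fin_cases i <;> fin_cases j <;> simp_all
            have h1 := skewAdjointSubmodule_apply L (m 0) (m 0)
            rw [hB] at h1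
            change B (L.1 (m 0)) (m 1) = 0
            rw [← this, hB]
            linarith }
      map_add' L M := by ext m; simp
      map_smul' c L := by ext m; simp }
  have hT : ∀ L m, T L m = B (L.1 (m 0)) (m 1) := fun _ _ => rfl
  have hbij : Function.Bijective T := by
    constructor
    · rw [injective_iff_map_eq_zero]
      intro L hL
      ext u
      refine hB'.1 _ fun v => ?_
      simpa [hL] using (hT L ![u, v]).symm
    · intro A
      have hA : ∀ u v, A ![u, v] = - A ![v, u] := fun u v => by
        have := A.map_swap ![v, u] (i := 0) (j := 1) (by simp)
        rw [← this]
        congr 1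
        ext i
        fin_cases i <;> rfl
      have h0 : ∀ u v x : E, Function.update ![u, v] 0 x = ![x, v] := fun u v x => by
        ext i; fin_cases i <;> rfl
      have h1 : ∀ u v x : E, Function.update ![u, v] 1 x = ![u, x] := fun u v x => by
        ext i; fin_cases i <;> rfl
      let L : E →ₗ[ℝ] E := (LinearMap.BilinForm.toDual B hB').symm.toLinearMap ∘ₗ
        LinearMap.mk₂ ℝ (fun u v => A ![u, v])
          (fun u u' v => by simpa only [h0, h1] using A.map_update_add ![u, v] 0 u u')
          (fun c u v => by simpa only [h0, h1] using A.map_update_smul ![u, v] 0 c u)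
          (fun u v v' => by simpa only [h0, h1] using A.map_update_add ![u, v] 1 v v')
          (fun c u v => by simpa only [h0, h1] using A.map_update_smul ![u, v] 1 c v)
      have hL : ∀ u v, B (L u) v = A ![u, v] := fun u v => by
        simp [L, LinearMap.BilinForm.apply_toDual_symm_apply]
      refine ⟨⟨L, (LinearMap.mem_skewAdjointSubmodule _).2 fun u v => ?_⟩, ?_⟩
      · rw [hL, hA, ← hL, hB]
        simp
      · ext m
        rw [hT, hL]
        congr 1
        ext i
        fin_cases i <;> rfl
  rw [(LinearEquiv.ofBijective T hbij).finrank_eq,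
    (exteriorPower.alternatingMapLinearEquiv).finrank_eq, finrank_linearMap,
    exteriorPower.finrank_eq, finrank_self, mul_one]


theorem HasFDerivAt.eq_of_eqOn {F : Type*} [NormedAddCommGroup F] [NormedSpace ℝ F]
    {f g : E → F} {f' g' : E →L[ℝ] F} {x : E} {U : Set E} (hf : HasFDerivAt f f' x)
    (hg : HasFDerivAt g g' x) (hU : IsOpen U) (hx : x ∈ U) (h : EqOn f g U) : f' = g' :=
  (hf.congr_of_eventuallyEq (h.eventuallyEq_of_mem (hU.mem_nhds hx)).symm).unique hg

theorem ContDiffOn.isSymmSndFDerivAt_of_isOpen {F : Type*} [NormedAddCommGroup F] [NormedSpace ℝ F]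
    {f : E → F} {U : Set E} {x : E} (hf : ContDiffOn ℝ (⊤ : ℕ∞) f U) (hU : IsOpen U)
    (hx : x ∈ U) : IsSymmSndFDerivAt ℝ f x :=
  (hf.contDiffAt (hU.mem_nhds hx)).isSymmSndFDerivAt (by
    rw [minSmoothness_of_isRCLikeNormedField]
    exact WithTop.coe_le_coe.2 (le_top : (2 : ℕ∞) ≤ ⊤))

/-- The functional `M ↦ B (M u) v` on endomorphisms. -/
noncomputable def matrixCoeff [FiniteDimensional ℝ E] (B : LinearMap.BilinForm ℝ E) (u v : E) :
    (E →L[ℝ] E) →L[ℝ] ℝ :=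
  (B.toContinuousBilinearMap.flip v).comp (ContinuousLinearMap.apply ℝ E u)

@[simp]
theorem matrixCoeff_apply [FiniteDimensional ℝ E] (B : LinearMap.BilinForm ℝ E) (u v : E)
    (M : E →L[ℝ] E) : matrixCoeff B u v M = B (M u) v := rfl

namespace IsConformalKillingOn

variable [FiniteDimensional ℝ E] {B : LinearMap.BilinForm ℝ E} {U : Set E} {ξ : E → E} {Ψ : E → ℝ}

/-- The conformal factor of a smooth conformal Killing vector is smooth. -/
theorem contDiffOn_factor (h : IsConformalKillingOn B U ξ Ψ) (hB : ∀ u v, B u v = B v u)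
    (hU : IsOpen U)
    (hξ : ContDiffOn ℝ (⊤ : ℕ∞) ξ U) {e f : E} (he : B e f ≠ 0) :
    ContDiffOn ℝ (⊤ : ℕ∞) Ψ U := by
  have h1 : ContDiffOn ℝ (⊤ : ℕ∞) (fderiv ℝ ξ) U := hξ.fderiv_of_isOpen hU (by simp)
  have h2 : ContDiffOn ℝ (⊤ : ℕ∞) (fun x => (2 * B e f)⁻¹ *
      (matrixCoeff B e f (fderiv ℝ ξ x) + matrixCoeff B f e (fderiv ℝ ξ x))) U :=
    contDiffOn_const.mul (((matrixCoeff B e f).contDiff.comp_contDiffOn h1).add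
      ((matrixCoeff B f e).contDiff.comp_contDiffOn h1))
  refine h2.congr fun x hx => ?_
  have := h x hx e f
  simp only [matrixCoeff_apply]
  rw [hB _ e, this]
  field_simp

/-- The second derivatives of a conformal Killing vector are determined by the derivative of its
conformal factor. -/
theorem second_fderiv (h : IsConformalKillingOn B U ξ Ψ) (hB : ∀ u v, B u v = B v u)
    (hU : IsOpen U) (hξ : ContDiffOn ℝ (⊤ : ℕ∞) ξ U) (hΨ : ContDiffOn ℝ (⊤ : ℕ∞) Ψ U) {x : E}
    (hx : x ∈ U) (w u v : E) :
    B (fderiv ℝ (fderiv ℝ ξ) x w u) v =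
      fderiv ℝ Ψ x w * B u v + fderiv ℝ Ψ x u * B w v - fderiv ℝ Ψ x v * B w u := by
  have h1 : ContDiffOn ℝ (⊤ : ℕ∞) (fderiv ℝ ξ) U := hξ.fderiv_of_isOpen hU (by simp)
  have hd : HasFDerivAt (fderiv ℝ ξ) (fderiv ℝ (fderiv ℝ ξ) x) x :=
    ((h1.contDiffAt (hU.mem_nhds hx)).differentiableAt (by simp)).hasFDerivAt
  have hp : HasFDerivAt Ψ (fderiv ℝ Ψ x) x :=
    ((hΨ.contDiffAt (hU.mem_nhds hx)).differentiableAt (by simp)).hasFDerivAt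
  refine koszul_formula (fun w u v => B (fderiv ℝ (fderiv ℝ ξ) x w u) v) (fderiv ℝ Ψ x)
    (fun u v => B u v) (fun w u v => ?_) (fun w u v => ?_) w u v
  · have := hξ.isSymmSndFDerivAt_of_isOpen hU hx w u
    simp only [this]
  · have hl := ((matrixCoeff B u v + matrixCoeff B v u).hasFDerivAt.comp x hd)
    have hr := hp.const_mul (2 * B u v)
    have := hl.eq_of_eqOn hr hU hx fun y hy => by
      have := h y hy u v
      rw [hB u] at this
      simp only [Function.comp_apply, add_apply, matrixCoeff_apply, this]
      ring
    have := congrArg (fun T => T w) this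
    simp at this
    rw [this]
    ring

/-- The conformal factor of a conformal Killing vector of a flat metric is affine. -/
theorem second_fderiv_factor_eq_zero (h : IsConformalKillingOn B U ξ Ψ)
    (hE : 3 ≤ finrank ℝ E) (hB : ∀ u v, B u v = B v u) (hB' : B.Nondegenerate)
    (hU : IsOpen U) (hξ : ContDiffOn ℝ (⊤ : ℕ∞) ξ U) (hΨ : ContDiffOn ℝ (⊤ : ℕ∞) Ψ U) {x : E}
    (hx : x ∈ U) : fderiv ℝ (fderiv ℝ Ψ) x = 0 := by
  have h1 : ContDiffOn ℝ (⊤ : ℕ∞) (fderiv ℝ ξ) U := hξ.fderiv_of_isOpen hU (by simp)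
  have h2 : ContDiffOn ℝ (⊤ : ℕ∞) (fderiv ℝ (fderiv ℝ ξ)) U := h1.fderiv_of_isOpen hU (by simp)
  have h3 : ContDiffOn ℝ (⊤ : ℕ∞) (fderiv ℝ Ψ) U := hΨ.fderiv_of_isOpen hU (by simp)
  have hd : HasFDerivAt (fderiv ℝ (fderiv ℝ ξ)) (fderiv ℝ (fderiv ℝ (fderiv ℝ ξ)) x) x :=
    ((h2.contDiffAt (hU.mem_nhds hx)).differentiableAt (by simp)).hasFDerivAt
  have hp : HasFDerivAt (fderiv ℝ Ψ) (fderiv ℝ (fderiv ℝ Ψ) x) x :=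
    ((h3.contDiffAt (hU.mem_nhds hx)).differentiableAt (by simp)).hasFDerivAt
  have happ : ∀ a, HasFDerivAt (fun y => fderiv ℝ Ψ y a)
      ((ContinuousLinearMap.apply ℝ ℝ a).comp (fderiv ℝ (fderiv ℝ Ψ) x)) x := fun a =>
    (ContinuousLinearMap.apply ℝ ℝ a).hasFDerivAt.comp x hp
  have third : ∀ z w u v, B (fderiv ℝ (fderiv ℝ (fderiv ℝ ξ)) x z w u) v =
      fderiv ℝ (fderiv ℝ Ψ) x z w * B u v + fderiv ℝ (fderiv ℝ Ψ) x z u * B w v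
        - fderiv ℝ (fderiv ℝ Ψ) x z v * B w u := by
    intro z w u v
    have hl := (((matrixCoeff B u v).comp
      (ContinuousLinearMap.apply ℝ (E →L[ℝ] E) w)).hasFDerivAt.comp x hd)
    have hr := (((happ w).mul_const (B u v)).add ((happ u).mul_const (B w v))).sub
      ((happ v).mul_const (B w u))
    have := hl.eq_of_eqOn hr hU hx fun y hy => by
      simpa using h.second_fderiv hB hU hξ hΨ hy w u v
    have := congrArg (fun T => T z) this
    simp at this
    rw [this]
    ring
  refine eq_zero_of_conformal_integrability hE hB hB' _ fun z w u v => ?_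
  have hs := h1.isSymmSndFDerivAt_of_isOpen hU hx z w
  have hs' := hΨ.isSymmSndFDerivAt_of_isOpen hU hx z w
  have t1 := third z w u v
  have t2 := third w z u v
  rw [hs] at t1
  rw [hs'] at t1
  linarith

end IsConformalKillingOn

/-- The infinitesimal translations, rotations, dilations and special conformal transformations of
the flat metric `B`. -/
noncomputable def flatConformalField (B : LinearMap.BilinForm ℝ E) :
    (E × B.skewAdjointSubmodule × ℝ × E) →ₗ[ℝ] E → E where
  toFun p x := p.1 + p.2.1.1 x + p.2.2.1 • x + ((2 * B p.2.2.2 x) • x - B x x • p.2.2.2)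
  map_add' p q := by
    ext x
    simp only [Prod.fst_add, Prod.snd_add, Submodule.coe_add, LinearMap.add_apply, map_add,
      Pi.add_apply]
    module
  map_smul' c p := by
    ext x
    simp only [Prod.smul_fst, Prod.smul_snd, Submodule.coe_smul, LinearMap.smul_apply, map_smul,
      Pi.smul_apply, smul_eq_mul, RingHom.id_apply]
    module

theorem flatConformalField_apply (B : LinearMap.BilinForm ℝ E)
    (p : E × B.skewAdjointSubmodule × ℝ × E) (x : E) :
    flatConformalField B p x =
      p.1 + p.2.1.1 x + p.2.2.1 • x + ((2 * B p.2.2.2 x) • x - B x x • p.2.2.2) := rfl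

section FiniteDimensional

variable [FiniteDimensional ℝ E] {B : LinearMap.BilinForm ℝ E} {U : Set E}

theorem contDiff_flatConformalField (p : E × B.skewAdjointSubmodule × ℝ × E) :
    ContDiff ℝ (⊤ : ℕ∞) (flatConformalField B p) := by
  have hB : ContDiff ℝ (⊤ : ℕ∞) fun x => B.toContinuousBilinearMap x x := by fun_prop
  have hb : ContDiff ℝ (⊤ : ℕ∞) fun x => B.toContinuousBilinearMap p.2.2.2 x := by fun_prop
  have hL : ContDiff ℝ (⊤ : ℕ∞) fun x => LinearMap.toContinuousLinearMap (p.2.1.1 : E →ₗ[ℝ] E) x := by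
    fun_prop
  exact ((contDiff_const.add hL).add (contDiff_const.smul contDiff_id)).add
    (((contDiff_const.mul hb).smul contDiff_id).sub (hB.smul contDiff_const))

theorem fderiv_flatConformalField (hB : ∀ u v, B u v = B v u)
    (p : E × B.skewAdjointSubmodule × ℝ × E) (x u : E) :
    fderiv ℝ (flatConformalField B p) x u = p.2.1.1 u + p.2.2.1 • u +
      ((2 * B p.2.2.2 u) • x + (2 * B p.2.2.2 x) • u - (2 * B x u) • p.2.2.2) := by
  have hL := (LinearMap.toContinuousLinearMap (p.2.1.1 : E →ₗ[ℝ] E)).hasFDerivAt (x := x)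
  have hb := (B.toContinuousBilinearMap p.2.2.2).hasFDerivAt (x := x)
  have hB' := B.toContinuousBilinearMap.hasFDerivAt.clm_apply (hasFDerivAt_id x)
  have := (((hL.const_add p.1).add ((hasFDerivAt_id x).const_smul p.2.2.1)).add
    (((hb.const_mul 2).smul (hasFDerivAt_id x)).sub (hB'.smul_const p.2.2.2)))
  have h' : HasFDerivAt (flatConformalField B p) _ x := this
  rw [h'.fderiv]
  simp [hB u x]
  module

theorem isConformalKillingOn_flatConformalField (hB : ∀ u v, B u v = B v u) (U : Set E)
    (p : E × B.skewAdjointSubmodule × ℝ × E) :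
    IsConformalKillingOn B U (flatConformalField B p) fun x => p.2.2.1 + 2 * B p.2.2.2 x := by
  intro x _ u v
  simp only [fderiv_flatConformalField hB, map_add, map_sub, map_smul, LinearMap.add_apply,
    LinearMap.sub_apply, LinearMap.smul_apply, smul_eq_mul, skewAdjointSubmodule_apply]
  rw [hB u x, hB u p.2.2.2]
  ring

/-- Liouville's theorem, infinitesimal version: every smooth conformal Killing vector of a flat
metric on a connected open set is the restriction of a polynomial one. -/
theorem IsConformalKillingOn.exists_eqOn_flatConformalField {ξ : E → E} {Ψ : E → ℝ}
    (h : IsConformalKillingOn B U ξ Ψ)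
    (hE : 3 ≤ finrank ℝ E) (hB : ∀ u v, B u v = B v u) (hB' : B.Nondegenerate)
    (hU : IsOpen U) (hU' : IsConnected U) (hξ : ContDiffOn ℝ (⊤ : ℕ∞) ξ U) :
    ∃ p, EqOn (flatConformalField B p) ξ U := by
  obtain ⟨x₀, hx₀⟩ := hU'.nonempty
  have : Nontrivial E := nontrivial_of_finrank_pos (R := ℝ) (by omega)
  obtain ⟨e, he⟩ := exists_ne (0 : E)
  obtain ⟨f, hf⟩ : ∃ f, B e f ≠ 0 := by
    by_contra! hc
    exact he (hB'.1 e hc)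
  have hΨ := h.contDiffOn_factor hB hU hξ hf
  have hdΨ : ContDiffOn ℝ (⊤ : ℕ∞) (fderiv ℝ Ψ) U := hΨ.fderiv_of_isOpen hU (by simp)
  obtain ⟨φ, hφ⟩ := hU.exists_is_const_of_fderiv_eq_zero hU'.isPreconnected
    (hdΨ.differentiableOn (by simp))
    fun x hx => h.second_fderiv_factor_eq_zero hE hB hB' hU hξ hΨ hx
  set b := (LinearMap.BilinForm.toDual B hB').symm ((2⁻¹ : ℝ) • (φ : E →ₗ[ℝ] ℝ)) with hb_def
  have hb : ∀ w, 2 * B b w = φ w := fun w => by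
    rw [hb_def, LinearMap.BilinForm.apply_toDual_symm_apply]
    simp
  have hQ := contDiff_flatConformalField (B := B) (0, 0, 0, b)
  have hη := h.sub (isConformalKillingOn_flatConformalField hB U (0, 0, 0, b))
    (fun x hx => (hξ.contDiffAt (hU.mem_nhds hx)).differentiableAt (by simp))
    (fun x _ => hQ.contDiffAt.differentiableAt (by simp))
  set η := ξ - flatConformalField B (0, 0, 0, b)
  have hηs : ContDiffOn ℝ (⊤ : ℕ∞) η U := hξ.sub hQ.contDiffOn
  have hηΨ := hη.contDiffOn_factor hB hU hηs hf
  have hdη : ContDiffOn ℝ (⊤ : ℕ∞) (fderiv ℝ η) U := hηs.fderiv_of_isOpen hU (by simp)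
  obtain ⟨M, hM⟩ := hU.exists_is_const_of_fderiv_eq_zero hU'.isPreconnected
    (hdη.differentiableOn (by simp)) fun x hx => by
      have h0 : fderiv ℝ (Ψ - fun x => 0 + 2 * B b x) x = 0 := by
        have h1 : HasFDerivAt Ψ (fderiv ℝ Ψ x) x :=
          ((hΨ.contDiffAt (hU.mem_nhds hx)).differentiableAt (by simp)).hasFDerivAt
        have h2 : HasFDerivAt (fun x => 0 + 2 * B b x) φ x := by
          simpa only [hb, zero_add] using φ.hasFDerivAt (x := x)
        rw [(h1.sub h2).fderiv, hφ x hx, sub_self]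
      ext w u
      refine hB'.1 _ fun v => ?_
      rw [hη.second_fderiv hB hU hηs hηΨ hx, h0]
      simp
  obtain ⟨a, ha⟩ := hU.exists_is_const_of_fderiv_eq_zero (f := fun x => η x - M x)
    hU'.isPreconnected ((hηs.differentiableOn (by simp)).sub M.differentiable.differentiableOn)
    fun x hx => by
      have h1 : HasFDerivAt η M x := by
        rw [← hM x hx]
        exact ((hηs.contDiffAt (hU.mem_nhds hx)).differentiableAt (by simp)).hasFDerivAt
      exact (h1.sub M.hasFDerivAt).fderiv.trans (sub_self M)
  obtain ⟨μ, hμ⟩ : ∃ μ, ∀ u v, B (M u) v + B u (M v) = 2 * μ * B u v :=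
    ⟨_, fun u v => by simpa only [hM x₀ hx₀] using hη x₀ hx₀ u v⟩
  refine ⟨(a, ⟨(M : E →ₗ[ℝ] E) - μ • LinearMap.id,
    (LinearMap.mem_skewAdjointSubmodule _).2 fun u v => ?_⟩, μ, b), fun x hx => ?_⟩
  · simp
    linarith [hμ u v]
  · have := ha x hx
    simp only [η, Pi.sub_apply, flatConformalField_apply] at this
    simp only [flatConformalField_apply, ← this]
    simp

theorem flatConformalField_eq_zero_of_eqOn [Nontrivial E] (hB : ∀ u v, B u v = B v u)
    (hB' : B.Nondegenerate) (hU : IsOpen U) (hU' : U.Nonempty)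
    {p : E × B.skewAdjointSubmodule × ℝ × E} (h : EqOn (flatConformalField B p) 0 U) : p = 0 := by
  obtain ⟨x₀, hx₀⟩ := hU'
  obtain ⟨e, he⟩ := exists_ne (0 : E)
  obtain ⟨f, hf⟩ : ∃ f, B e f ≠ 0 := by
    by_contra! hc
    exact he (hB'.1 e hc)
  have hd : ∀ x ∈ U, fderiv ℝ (flatConformalField B p) x = 0 := fun x hx =>
    ((contDiff_flatConformalField p).contDiffAt.differentiableAt (by simp)).hasFDerivAt.eq_of_eqOn
      (hasFDerivAt_const 0 x) hU hx h
  have hc : ∀ x ∈ U, p.2.2.1 + 2 * B p.2.2.2 x = 0 := fun x hx => by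
    have := isConformalKillingOn_flatConformalField hB U p x hx e f
    simpa [hd x hx, hf] using this
  have hb : p.2.2.2 = 0 := by
    refine hB'.1 _ fun w => ?_
    have h1 := ((B.toContinuousBilinearMap p.2.2.2).hasFDerivAt (x := x₀)).const_mul 2
    have h2 := (h1.const_add p.2.2.1).eq_of_eqOn (hasFDerivAt_const 0 x₀) hU hx₀ hc
    simpa using congrArg (fun T => T w) h2
  have hμ : p.2.2.1 = 0 := by simpa [hb] using hc x₀ hx₀
  have hL : p.2.1 = 0 := by
    ext u
    have := fderiv_flatConformalField hB p x₀ u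
    simpa [hd x₀ hx₀, hb, hμ] using this.symm
  have ha : p.1 = 0 := by
    have := h hx₀
    simpa [flatConformalField_apply, hb, hμ, hL] using this
  exact Prod.ext ha (Prod.ext hL (Prod.ext hμ hb))

end FiniteDimensional

end FlatConformalKilling

/-- For `n ≥ 3` and a nonempty open connected `U ⊆ ℝⁿ`, the set of smooth conformal
Killing vectors of a flat metric `B` on `U` (viewed as functions `U → ℝⁿ`) is a real
vector space of dimension `(n+1)(n+2)/2`. -/
theorem stmt_4 (n : ℕ) (hn : 3 ≤ n)
    (B : (Fin n → ℝ) →ₗ[ℝ] (Fin n → ℝ) →ₗ[ℝ] ℝ)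
    (hSymm : ∀ u v, B u v = B v u)
    (hNondeg : ∀ u, (∀ v, B u v = 0) → u = 0)
    (U : Set (Fin n → ℝ)) (hUopen : IsOpen U) (hUconn : IsConnected U) :
    ∃ S : Submodule ℝ (↥U → (Fin n → ℝ)),
      ((S : Set (↥U → (Fin n → ℝ))) =
        {g | ∃ ξ : (Fin n → ℝ) → (Fin n → ℝ),
              ContDiffOn ℝ (⊤ : ℕ∞) ξ U ∧
              (∃ Ψ : (Fin n → ℝ) → ℝ, ∀ x ∈ U, ∀ u v,
                B (fderiv ℝ ξ x u) v + B u (fderiv ℝ ξ x v) = 2 * Ψ x * B u v) ∧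
              (∀ x : ↥U, g x = ξ (x : Fin n → ℝ))}) ∧
      Module.finrank ℝ S = (n + 1) * (n + 2) / 2 := by
  have hE : finrank ℝ (Fin n → ℝ) = n := by simp
  have : Nontrivial (Fin n → ℝ) := nontrivial_of_finrank_pos (R := ℝ) (by omega)
  have hB' : LinearMap.BilinForm.Nondegenerate B :=
    ⟨hNondeg, fun v hv => hNondeg v fun u => (hSymm v u).trans (hv u)⟩
  let T := LinearMap.funLeft ℝ (Fin n → ℝ) (Subtype.val : U → Fin n → ℝ) ∘ₗ flatConformalField B
  have hT : Function.Injective T := by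
    rw [injective_iff_map_eq_zero]
    exact fun p hp => flatConformalField_eq_zero_of_eqOn hSymm hB' hUopen hUconn.nonempty
      fun x hx => congrFun hp ⟨x, hx⟩
  refine ⟨LinearMap.range T, ?_, ?_⟩
  · ext g
    constructor
    · rintro ⟨p, rfl⟩
      exact ⟨flatConformalField B p, (contDiff_flatConformalField p).contDiffOn,
        ⟨_, isConformalKillingOn_flatConformalField hSymm U p⟩, fun _ => rfl⟩
    · rintro ⟨ξ, hξ, ⟨Ψ, hΨ⟩, hg⟩
      obtain ⟨p, hp⟩ := IsConformalKillingOn.exists_eqOn_flatConformalField hΨ (by omega) hSymm hB'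
        hUopen hUconn hξ
      exact ⟨p, funext fun x => (hp x.2).trans (hg x).symm⟩
  · rw [LinearMap.finrank_range_of_inj hT, finrank_prod, finrank_prod, finrank_prod, finrank_self,
      finrank_skewAdjointSubmodule hSymm hB', hE]
    have h1 := Nat.triangle_succ (n + 1)
    have h2 := Nat.triangle_succ n
    rw [Nat.choose_two_right]
    rw [show (n + 1) * (n + 2) = (n + 1 + 1) * (n + 1 + 1 - 1) by simp; ring, h1, h2]
    omega
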